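/- arXiv:1604.00272 — 7 statements merged into one kernel-verified Lean document; each statement's English description precedes it below -/
import Mathlib

section
/- Let E, A : M ⟶ V be a pair of morphisms in an abelian category. Then the composite of the kernel inclusion of p(A) with E, and the composite of the kernel inclusion of p(A) with A, each factor uniquely through the image inclusion im E ⟶ V; dually, the composites of E and of A with the cokernel projection V ⟶ coker r(A) each factor uniquely through the coimage projection M ⟶ coim E. Hence the observation-reduced system (E_o, A_o) : M_o ⟶ V_o and the control-reduced system (E_c, A_c) : M_c ⟶ V_c are well defined by these unique factorizations. -/
/-!
Statement 0: For a system `E A : M ⟶ V` in an abelian category, the composites of the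
kernel inclusion of `p(A) = A ≫ π_E` with `E` and with `A` factor uniquely through the
image inclusion `im E ⟶ V` (realized as `ker (π_E) ⟶ V`); dually, the composites of `E`
and `A` with the cokernel projection `V ⟶ coker r(A)` factor uniquely through the coimage
projection `M ⟶ coim E` (realized as `M ⟶ coker (ι_E)`).  These unique factorizations
define the observation-reduced system `(E_o, A_o)` and the control-reduced system
`(E_c, A_c)`.
-/

open CategoryTheory CategoryTheory.Limits

/-- A morphism annihilated by `g` factors uniquely through `kernel.ι g`. -/
theorem existsUnique_comp_kernel_ι {C : Type*} [Category C] [HasZeroMorphisms C] {W X Y : C}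
    (g : X ⟶ Y) [HasKernel g] (k : W ⟶ X) (hk : k ≫ g = 0) :
    ∃! l : W ⟶ kernel g, l ≫ kernel.ι g = k :=
  ⟨kernel.lift g k hk, kernel.lift_ι g k hk, fun l hl => by
    rw [← cancel_mono (kernel.ι g), hl, kernel.lift_ι]⟩

/-- A morphism annihilating `f` factors uniquely through `cokernel.π f`. -/
theorem existsUnique_cokernel_π_comp {C : Type*} [Category C] [HasZeroMorphisms C] {X Y Z : C}
    (f : X ⟶ Y) [HasCokernel f] (k : Y ⟶ Z) (hk : f ≫ k = 0) :
    ∃! l : cokernel f ⟶ Z, cokernel.π f ≫ l = k :=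
  ⟨cokernel.desc f k hk, cokernel.π_desc f k hk, fun l hl => by
    rw [← cancel_epi (cokernel.π f), hl, cokernel.π_desc]⟩

theorem kronecker_reduction_well_defined
    {C : Type*} [Category C] [Abelian C] {M V : C} (E A : M ⟶ V) :
    (∃! Eo : kernel (A ≫ cokernel.π E) ⟶ kernel (cokernel.π E),
        Eo ≫ kernel.ι (cokernel.π E) = kernel.ι (A ≫ cokernel.π E) ≫ E) ∧
    (∃! Ao : kernel (A ≫ cokernel.π E) ⟶ kernel (cokernel.π E),
        Ao ≫ kernel.ι (cokernel.π E) = kernel.ι (A ≫ cokernel.π E) ≫ A) ∧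
    (∃! Ec : cokernel (kernel.ι E) ⟶ cokernel (kernel.ι E ≫ A),
        cokernel.π (kernel.ι E) ≫ Ec = E ≫ cokernel.π (kernel.ι E ≫ A)) ∧
    (∃! Ac : cokernel (kernel.ι E) ⟶ cokernel (kernel.ι E ≫ A),
        cokernel.π (kernel.ι E) ≫ Ac = A ≫ cokernel.π (kernel.ι E ≫ A)) := by
  refine ⟨existsUnique_comp_kernel_ι _ _ ?_, existsUnique_comp_kernel_ι _ _ ?_,
    existsUnique_cokernel_π_comp _ _ ?_, existsUnique_cokernel_π_comp _ _ ?_⟩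
  · rw [Category.assoc, cokernel.condition, comp_zero]
  · rw [Category.assoc, kernel.condition]
  · rw [← Category.assoc, kernel.condition, zero_comp]
  · rw [← Category.assoc, cokernel.condition]
end

section
/- Let R be a commutative ring, M and V be R-modules, E, A : M →ₗ[R] V linear maps, and λ ∈ R. Consider the three properties: (i) λ•E + A is bijective; (ii) λ•E_o + A_o : M_o → V_o is bijective; (iii) range E ⊔ range A = ⊤ (i.e. every element of V is a sum of an element of the range of E and an element of the range of A). If any two of these properties hold, then so does the third. -/
/-!
Statement 13: for a commutative ring `R`, modules `M`, `V`, linear maps `E A : M →ₗ[R] V`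
and `λ ∈ R`, consider: (i) `λ•E + A` bijective; (ii) `λ•E_o + A_o : M_o → V_o` bijective;
(iii) `range E ⊔ range A = ⊤`.  If any two of these hold, then so does the third.
-/

noncomputable section

namespace PencilModules

variable {R : Type*} [CommRing R] {M V : Type*} [AddCommGroup M] [AddCommGroup V]
  [Module R M] [Module R V]

/-- `M_o = {x : M | A x ∈ range E}`, the kernel of the composite of `A` with the quotient
map `V → V ⧸ range E`. -/
def Mo (E A : M →ₗ[R] V) : Submodule R M := Submodule.comap A (LinearMap.range E)

/-- The corestriction `E_o : M_o →ₗ V_o` of `E`, with `V_o = range E`. -/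
def Eo (E A : M →ₗ[R] V) : Mo E A →ₗ[R] LinearMap.range E :=
  E.restrict fun x _ => LinearMap.mem_range_self E x

/-- The corestriction `A_o : M_o →ₗ V_o` of `A`. -/
def Ao (E A : M →ₗ[R] V) : Mo E A →ₗ[R] LinearMap.range E :=
  A.restrict fun _ hx => hx

theorem mem_Mo_iff (E A : M →ₗ[R] V) (lam : R) (x : M) :
    x ∈ Mo E A ↔ (lam • E + A) x ∈ LinearMap.range E :=
  ((LinearMap.range E).add_mem_iff_right
    ((LinearMap.range E).smul_mem lam (LinearMap.mem_range_self E x))).symm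

theorem coe_reduced_pencil_apply (E A : M →ₗ[R] V) (lam : R) (x : Mo E A) :
    ((lam • Eo E A + Ao E A) x : V) = (lam • E + A) x := rfl

theorem range_sup_range_eq_top_of_bijective (E A : M →ₗ[R] V) (lam : R)
    (h : Function.Bijective ⇑(lam • E + A)) :
    LinearMap.range E ⊔ LinearMap.range A = ⊤ := by
  refine eq_top_iff.2 fun v _ => ?_
  obtain ⟨x, rfl⟩ := h.2 v
  exact Submodule.add_mem_sup
    ((LinearMap.range E).smul_mem lam (LinearMap.mem_range_self E x))
    (LinearMap.mem_range_self A x)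

theorem reduced_pencil_bijective (E A : M →ₗ[R] V) (lam : R)
    (h : Function.Bijective ⇑(lam • E + A)) :
    Function.Bijective ⇑(lam • Eo E A + Ao E A) := by
  refine ⟨fun x y hxy => Subtype.ext (h.1 ?_), fun w => ?_⟩
  · rw [← coe_reduced_pencil_apply, ← coe_reduced_pencil_apply, hxy]
  · obtain ⟨x, hx⟩ := h.2 w
    exact ⟨⟨x, (mem_Mo_iff E A lam x).2 (hx ▸ w.2)⟩, Subtype.ext hx⟩

theorem pencil_bijective_of_reduced (E A : M →ₗ[R] V) (lam : R)
    (h : Function.Bijective ⇑(lam • Eo E A + Ao E A))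
    (hsup : LinearMap.range E ⊔ LinearMap.range A = ⊤) :
    Function.Bijective ⇑(lam • E + A) := by
  constructor
  · refine (injective_iff_map_eq_zero _).2 fun x hx => ?_
    have hmem : x ∈ Mo E A := (mem_Mo_iff E A lam x).2 (hx ▸ Submodule.zero_mem _)
    have hzero : (⟨x, hmem⟩ : Mo E A) = 0 :=
      (injective_iff_map_eq_zero _).1 h.1 _ (Subtype.ext hx)
    exact congrArg Subtype.val hzero
  · intro v
    have hv : v ∈ LinearMap.range E ⊔ LinearMap.range A := hsup ▸ Submodule.mem_top
    obtain ⟨_, ⟨a, rfl⟩, _, ⟨b, rfl⟩, rfl⟩ := Submodule.mem_sup.1 hv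
    obtain ⟨m, hm⟩ := h.2 ⟨E (a - lam • b), LinearMap.mem_range_self E _⟩
    have hm' : (lam • E + A) m = E (a - lam • b) := congrArg Subtype.val hm
    refine ⟨m + b, ?_⟩
    rw [map_add, hm', map_sub, map_smul, LinearMap.add_apply, LinearMap.smul_apply]
    abel

theorem two_out_of_three (E A : M →ₗ[R] V) (lam : R) :
    (Function.Bijective ⇑(lam • E + A) → Function.Bijective ⇑(lam • Eo E A + Ao E A) →
      LinearMap.range E ⊔ LinearMap.range A = ⊤) ∧
    (Function.Bijective ⇑(lam • E + A) → LinearMap.range E ⊔ LinearMap.range A = ⊤ →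
      Function.Bijective ⇑(lam • Eo E A + Ao E A)) ∧
    (Function.Bijective ⇑(lam • Eo E A + Ao E A) →
      LinearMap.range E ⊔ LinearMap.range A = ⊤ →
      Function.Bijective ⇑(lam • E + A)) :=
  ⟨fun h _ => range_sup_range_eq_top_of_bijective E A lam h,
    fun h _ => reduced_pencil_bijective E A lam h,
    pencil_bijective_of_reduced E A lam⟩

end PencilModules

end
end

section
/- Let R be a commutative ring, M and V be R-modules, and E, A : M →ₗ[R] V linear maps. Exactly one of the following two alternatives holds: (a) if range E ⊔ range A = ⊤, then ρ(E,A) = ρ(E_o, A_o); (b) if range E ⊔ range A ≠ ⊤, then ρ(E,A) = ∅. Moreover, in all cases ρ(E,A) ⊆ ρ(E_o, A_o). -/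
/-!
Statement 14: for a commutative ring `R`, modules `M`, `V` and linear maps
`E A : M →ₗ[R] V`, with resolvent set `ρ(F,B) := {λ | λ•F + B bijective}`:
(a) if `range E ⊔ range A = ⊤` then `ρ(E,A) = ρ(E_o,A_o)`;
(b) if `range E ⊔ range A ≠ ⊤` then `ρ(E,A) = ∅`;
and in all cases `ρ(E,A) ⊆ ρ(E_o,A_o)`.
-/

noncomputable section

namespace PencilModules

variable {R : Type*} [CommRing R] {M V : Type*} [AddCommGroup M] [AddCommGroup V]
  [Module R M] [Module R V]

/-- The resolvent set of a system `(F, B)` of linear maps. -/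
def resolvent {M' V' : Type*} [AddCommGroup M'] [AddCommGroup V'] [Module R M']
    [Module R V'] (F B : M' →ₗ[R] V') : Set R :=
  {lam : R | Function.Bijective ⇑(lam • F + B)}

theorem mem_Mo_of_smul_add_mem_range {E A : M →ₗ[R] V} {lam : R} {x : M}
    (h : (lam • E + A) x ∈ LinearMap.range E) : x ∈ Mo E A := by
  change A x ∈ LinearMap.range E
  have hE : lam • E x ∈ LinearMap.range E :=
    Submodule.smul_mem _ _ (LinearMap.mem_range_self E x)
  simpa using sub_mem h hE

theorem range_sup_range_eq_top_of_mem_resolvent {E A : M →ₗ[R] V} {lam : R}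
    (h : lam ∈ resolvent E A) : LinearMap.range E ⊔ LinearMap.range A = ⊤ := by
  refine eq_top_iff.2 fun v _ => ?_
  obtain ⟨x, rfl⟩ := h.2 v
  exact Submodule.add_mem_sup (Submodule.smul_mem _ _ (LinearMap.mem_range_self E x))
    (LinearMap.mem_range_self A x)

theorem resolvent_subset_resolvent_Eo_Ao (E A : M →ₗ[R] V) :
    resolvent E A ⊆ resolvent (Eo E A) (Ao E A) := by
  rintro lam ⟨hinj, hsurj⟩
  refine ⟨fun x y hxy => Subtype.ext (hinj (congrArg Subtype.val hxy)), fun v => ?_⟩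
  obtain ⟨x, hx⟩ := hsurj v
  exact ⟨⟨x, mem_Mo_of_smul_add_mem_range (hx ▸ v.2)⟩, Subtype.ext hx⟩

theorem resolvent_Eo_Ao_subset_resolvent {E A : M →ₗ[R] V}
    (htop : LinearMap.range E ⊔ LinearMap.range A = ⊤) :
    resolvent (Eo E A) (Ao E A) ⊆ resolvent E A := by
  rintro lam ⟨hinj, hsurj⟩
  refine ⟨(injective_iff_map_eq_zero _).2 fun x hx => ?_, fun v => ?_⟩
  · have hxo : x ∈ Mo E A := mem_Mo_of_smul_add_mem_range (hx ▸ zero_mem _)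
    exact congrArg Subtype.val
      ((injective_iff_map_eq_zero _).1 hinj ⟨x, hxo⟩ (Subtype.ext hx))
  · obtain ⟨_, ⟨x, rfl⟩, _, ⟨z, rfl⟩, rfl⟩ :=
      Submodule.mem_sup.1 (htop ▸ Submodule.mem_top : v ∈ LinearMap.range E ⊔ LinearMap.range A)
    obtain ⟨y, hy⟩ := hsurj ⟨E (x - lam • z), LinearMap.mem_range_self E _⟩
    have hy' : (lam • E + A) y = E (x - lam • z) := congrArg Subtype.val hy
    refine ⟨y + z, ?_⟩
    rw [map_add, hy']
    simp only [map_sub, map_smul, LinearMap.add_apply, LinearMap.smul_apply]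
    abel

theorem resolvent_alternative (E A : M →ₗ[R] V) :
    (LinearMap.range E ⊔ LinearMap.range A = ⊤ →
      resolvent E A = resolvent (Eo E A) (Ao E A)) ∧
    (LinearMap.range E ⊔ LinearMap.range A ≠ ⊤ → resolvent E A = ∅) ∧
    resolvent E A ⊆ resolvent (Eo E A) (Ao E A) := by
  refine ⟨fun h => ?_, fun h => ?_, resolvent_subset_resolvent_Eo_Ao E A⟩
  · exact (resolvent_subset_resolvent_Eo_Ao E A).antisymm (resolvent_Eo_Ao_subset_resolvent h)
  · exact Set.eq_empty_of_forall_notMem fun _ hlam =>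
      h (range_sup_range_eq_top_of_mem_resolvent hlam)

end PencilModules

end
end

section
/- Let K be a field, M and V finite-dimensional K-vector spaces, and E, A : M →ₗ[K] V linear maps. Define the nilpotency defect α₁ := finrank((Submodule.map A (ker E) ⊔ range E) ⧸ range E) (the rank of the map ker E → V ⧸ range E induced by A). Then: (i) α₁ = finrank(ker E) − finrank(ker E ⊓ M_o); (ii) α₁ = finrank(V ⧸ range E) − finrank(V ⧸ (range E ⊔ Submodule.map A (ker E))); (iii) ker A ≤ M_o, so the kernel of A_o equals ker A and finrank(ker A_o) = finrank(ker A); (iv) the cokernel of A_c is isomorphic to V ⧸ range A, so finrank(coker A_c) = finrank(V ⧸ range A). -/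
noncomputable section

namespace PencilDefects

open Module

variable {K : Type*} [Field K] {M V : Type*} [AddCommGroup M] [AddCommGroup V]
  [Module K M] [Module K V] [FiniteDimensional K M] [FiniteDimensional K V]

/-- `M_o = {x : M | A x ∈ range E}`. -/
def Mo (E A : M →ₗ[K] V) : Submodule K M := Submodule.comap A (LinearMap.range E)

/-- The corestriction `E_o : M_o →ₗ V_o` of `E`, with `V_o = range E`. -/
def Eo (E A : M →ₗ[K] V) : Mo E A →ₗ[K] LinearMap.range E :=
  E.restrict fun x _ => LinearMap.mem_range_self E x

/-- The corestriction `A_o : M_o →ₗ V_o` of `A`. -/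
def Ao (E A : M →ₗ[K] V) : Mo E A →ₗ[K] LinearMap.range E :=
  A.restrict fun _ hx => hx

/-- The map `ker E → V ⧸ range E` induced by `A` (restriction of `A` to `ker E` followed
by projection on the cokernel of `E`). -/
def prMap (E A : M →ₗ[K] V) : LinearMap.ker E →ₗ[K] V ⧸ LinearMap.range E :=
  (LinearMap.range E).mkQ ∘ₗ A ∘ₗ (LinearMap.ker E).subtype

/-- The nilpotency defect `α₁`, the rank of the map `ker E → V ⧸ range E` induced by `A`;
equivalently `finrank ((map A (ker E) ⊔ range E) ⧸ range E)`. -/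
def alpha1 (E A : M →ₗ[K] V) : ℕ := finrank K (LinearMap.range (prMap E A))

/-- The control-reduced map `E_c : M ⧸ ker E →ₗ V ⧸ A (ker E)` induced by `E`. -/
def Ec (E A : M →ₗ[K] V) :
    (M ⧸ LinearMap.ker E) →ₗ[K] V ⧸ Submodule.map A (LinearMap.ker E) :=
  Submodule.liftQ _ ((Submodule.map A (LinearMap.ker E)).mkQ ∘ₗ E) (fun x hx => by
    simp only [LinearMap.mem_ker, LinearMap.comp_apply] at hx ⊢
    rw [hx, map_zero])

/-- The control-reduced map `A_c : M ⧸ ker E →ₗ V ⧸ A (ker E)` induced by `A`. -/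
def Ac (E A : M →ₗ[K] V) :
    (M ⧸ LinearMap.ker E) →ₗ[K] V ⧸ Submodule.map A (LinearMap.ker E) :=
  Submodule.liftQ _ ((Submodule.map A (LinearMap.ker E)).mkQ ∘ₗ A) (fun x hx => by
    simp only [LinearMap.mem_ker, LinearMap.comp_apply, Submodule.mkQ_apply]
    exact (Submodule.Quotient.mk_eq_zero _).mpr ⟨x, hx, rfl⟩)

omit [FiniteDimensional K M] [FiniteDimensional K V] in
lemma map_subtype_ker_prMap (E A : M →ₗ[K] V) :
    Submodule.map (LinearMap.ker E).subtype (LinearMap.ker (prMap E A)) =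
      LinearMap.ker E ⊓ Mo E A := by
  have h : LinearMap.ker (prMap E A) =
      Submodule.comap (LinearMap.ker E).subtype (Mo E A) := by
    ext x
    simp [prMap, Mo]
  rw [h, Submodule.map_comap_subtype]

omit [FiniteDimensional K M] [FiniteDimensional K V] in
lemma range_prMap (E A : M →ₗ[K] V) :
    LinearMap.range (prMap E A) =
      Submodule.map (LinearMap.range E).mkQ (Submodule.map A (LinearMap.ker E)) := by
  rw [prMap, LinearMap.range_comp, LinearMap.range_comp, Submodule.range_subtype]

omit [FiniteDimensional K M] [FiniteDimensional K V] in
lemma ker_le_Mo (E A : M →ₗ[K] V) : LinearMap.ker A ≤ Mo E A := by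
  intro x hx
  rw [Mo, Submodule.mem_comap, LinearMap.mem_ker.mp hx]
  exact Submodule.zero_mem _

omit [FiniteDimensional K M] [FiniteDimensional K V] in
lemma map_subtype_ker_Ao (E A : M →ₗ[K] V) :
    Submodule.map (Mo E A).subtype (LinearMap.ker (Ao E A)) = LinearMap.ker A := by
  have h : LinearMap.ker (Ao E A) =
      Submodule.comap (Mo E A).subtype (LinearMap.ker A) := by
    ext x
    exact Subtype.ext_iff
  rw [h, Submodule.map_comap_subtype, inf_eq_right.mpr (ker_le_Mo E A)]

omit [FiniteDimensional K M] [FiniteDimensional K V] in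
lemma range_Ac (E A : M →ₗ[K] V) :
    LinearMap.range (Ac E A) =
      Submodule.map (Submodule.map A (LinearMap.ker E)).mkQ (LinearMap.range A) := by
  rw [Ac, Submodule.range_liftQ, LinearMap.range_comp]

/-- The cokernel of `A_c` is the cokernel of `A`. -/
def cokerAcEquiv (E A : M →ₗ[K] V) :
    ((V ⧸ Submodule.map A (LinearMap.ker E)) ⧸ LinearMap.range (Ac E A)) ≃ₗ[K]
      V ⧸ LinearMap.range A :=
  Submodule.quotEquivOfEq _ _ (range_Ac E A) ≪≫ₗ
    Submodule.quotientQuotientEquivQuotient _ _ LinearMap.map_le_range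

/-!
Statement 15: relations between the nilpotency defect `α₁` and the kernels/cokernels of
the reduced systems, in finite-dimensional vector spaces.
-/

theorem nilpotency_defect_relations (E A : M →ₗ[K] V) :
    alpha1 E A =
      finrank K ↥(LinearMap.ker E) - finrank K ↥(LinearMap.ker E ⊓ Mo E A) ∧
    alpha1 E A =
      finrank K (V ⧸ LinearMap.range E) -
        finrank K (V ⧸ (LinearMap.range E ⊔ Submodule.map A (LinearMap.ker E))) ∧
    LinearMap.ker A ≤ Mo E A ∧
    Submodule.map (Mo E A).subtype (LinearMap.ker (Ao E A)) = LinearMap.ker A ∧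
    finrank K ↥(LinearMap.ker (Ao E A)) = finrank K ↥(LinearMap.ker A) ∧
    Nonempty (((V ⧸ Submodule.map A (LinearMap.ker E)) ⧸ LinearMap.range (Ac E A)) ≃ₗ[K]
      V ⧸ LinearMap.range A) ∧
    finrank K ((V ⧸ Submodule.map A (LinearMap.ker E)) ⧸ LinearMap.range (Ac E A)) =
      finrank K (V ⧸ LinearMap.range A) := by
  refine ⟨?_, ?_, ker_le_Mo E A, map_subtype_ker_Ao E A, ?_, ⟨cokerAcEquiv E A⟩,
    (cokerAcEquiv E A).finrank_eq⟩
  · rw [← map_subtype_ker_prMap, Submodule.finrank_map_subtype_eq, alpha1,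
      ← LinearMap.finrank_range_add_finrank_ker (prMap E A), Nat.add_sub_cancel]
  · have h := Submodule.finrank_quotient_add_finrank (LinearMap.range (prMap E A))
    have e := (Submodule.quotientQuotientEquivQuotientSup (LinearMap.range E)
      (Submodule.map A (LinearMap.ker E))).finrank_eq
    rw [← range_prMap] at e
    rw [alpha1, ← e, ← h, Nat.add_sub_cancel_left]
  · rw [← map_subtype_ker_Ao E A, Submodule.finrank_map_subtype_eq]

end PencilDefects

end
end

section
/- Let K be a field, M and V finite-dimensional K-vector spaces, and E, A : M →ₗ[K] V linear maps. Define α₁ := finrank((Submodule.map A (ker E) ⊔ range E) ⧸ range E), the observation defect β_o := finrank(V ⧸ (range E ⊔ range A)), and the control defect β_c := finrank(ker E ⊓ ker A). Then: (i) β_o = finrank(coker A) − finrank(coker A_o), i.e. β_o = finrank(V ⧸ range A) − (finrank(range E) − finrank(Submodule.map A M_o)); (ii) β_c = finrank(ker A) − finrank(ker A_c), where finrank(ker A_c) = finrank({x ∈ M : A x ∈ Submodule.map A (ker E)}) − finrank(ker E); (iii) finrank(coker E) − finrank(coker E_o) = α₁ + β_o, where finrank(coker E_o) = finrank(range E) −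 finrank(Submodule.map E M_o); (iv) finrank(ker E) − finrank(ker E_c) = α₁ + β_c, where finrank(ker E_c) = finrank({x ∈ M : E x ∈ Submodule.map A (ker E)}) − finrank(ker E). -/
noncomputable section

namespace PencilDefects

open Module

variable {K : Type*} [Field K] {M V : Type*} [AddCommGroup M] [AddCommGroup V]
  [Module K M] [Module K V] [FiniteDimensional K M] [FiniteDimensional K V]

/-- The observation defect `β_o = dim coker p(A) = dim (V ⧸ (range E ⊔ range A))`. -/
def betaObs (E A : M →ₗ[K] V) : ℕ :=
  finrank K (V ⧸ (LinearMap.range E ⊔ LinearMap.range A))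

/-- The control defect `β_c = dim ker r(A) = dim (ker E ⊓ ker A)`. -/
def betaCon (E A : M →ₗ[K] V) : ℕ :=
  finrank K ↥(LinearMap.ker E ⊓ LinearMap.ker A)

/-!
Statement 16: relations between the defects `α₁`, `β_o`, `β_c` and the kernels and
cokernels of the observation- and control-reduced systems.
-/

/-- Rank-nullity for the restriction of a linear map to a submodule. -/
theorem finrank_map_add_finrank_inf_ker {U W : Type*} [AddCommGroup U] [Module K U]
    [AddCommGroup W] [Module K W] (f : U →ₗ[K] W) (p : Submodule K U) [FiniteDimensional K p] :
    finrank K (p.map f) + finrank K ↥(p ⊓ LinearMap.ker f) = finrank K p := by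
  have h := (f.domRestrict p).finrank_range_add_finrank_ker
  rwa [LinearMap.range_domRestrict, LinearMap.ker_domRestrict,
    ← Submodule.finrank_map_subtype_eq p, Submodule.map_comap_subtype] at h

/-- The dimension of the preimage of a submodule under a linear map. -/
theorem finrank_comap_eq {U W : Type*} [AddCommGroup U] [Module K U] [FiniteDimensional K U]
    [AddCommGroup W] [Module K W] (f : U →ₗ[K] W) (q : Submodule K W) :
    finrank K (q.comap f) =
      finrank K ↥(LinearMap.range f ⊓ q) + finrank K (LinearMap.ker f) := by
  have h := finrank_map_add_finrank_inf_ker f (q.comap f)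
  rw [Submodule.map_comap_eq, inf_eq_right.mpr (LinearMap.ker_le_comap f)] at h
  exact h.symm

/-- The kernel of the map `U ⧸ p → W ⧸ q` induced by `f` is `(comap f q) ⧸ p`. -/
theorem finrank_ker_liftQ_mkQ_comp {U W : Type*} [AddCommGroup U] [Module K U]
    [FiniteDimensional K U] [AddCommGroup W] [Module K W] (f : U →ₗ[K] W)
    (p : Submodule K U) (q : Submodule K W) (h : p ≤ LinearMap.ker (q.mkQ ∘ₗ f)) :
    finrank K (LinearMap.ker (p.liftQ (q.mkQ ∘ₗ f) h)) + finrank K p =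
      finrank K (q.comap f) := by
  have hk : LinearMap.ker (q.mkQ ∘ₗ f) = q.comap f := by
    rw [LinearMap.ker_comp, Submodule.ker_mkQ]
  have e := finrank_map_add_finrank_inf_ker p.mkQ (q.comap f)
  rwa [Submodule.ker_mkQ, inf_eq_right.mpr (hk ▸ h), ← hk, ← Submodule.ker_liftQ _ _ h, hk] at e

/-- The defect `α₁` is the codimension of `A (ker E) ⊓ range E` in `A (ker E)`. -/
theorem alpha1_add_finrank_inf {U W : Type*} [AddCommGroup U] [Module K U] [FiniteDimensional K U]
    [AddCommGroup W] [Module K W] (E A : U →ₗ[K] W) :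
    alpha1 E A + finrank K ↥((LinearMap.ker E).map A ⊓ LinearMap.range E) =
      finrank K ((LinearMap.ker E).map A) := by
  have h := finrank_map_add_finrank_inf_ker (LinearMap.range E).mkQ ((LinearMap.ker E).map A)
  rwa [Submodule.ker_mkQ, ← Submodule.map_comp, ← Submodule.range_subtype (LinearMap.ker E),
    ← LinearMap.range_comp, Submodule.range_subtype] at h

/-- The cokernel of `E_o` has dimension `dim (range E) - dim (E M_o)`. -/
theorem finrank_coker_Eo_add {U W : Type*} [AddCommGroup U] [Module K U] [FiniteDimensional K U]
    [AddCommGroup W] [Module K W] (E A : U →ₗ[K] W) :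
    finrank K (↥(LinearMap.range E) ⧸ LinearMap.range (Eo E A)) +
      finrank K ((Mo E A).map E) = finrank K (LinearMap.range E) := by
  have h : (LinearMap.range (Eo E A)).map (LinearMap.range E).subtype = (Mo E A).map E := by
    rw [Eo, LinearMap.range_restrict, Submodule.map_comap_subtype,
      inf_eq_right.mpr LinearMap.map_le_range]
  rw [← h, Submodule.finrank_map_subtype_eq, Submodule.finrank_quotient_add_finrank]

theorem defect_dimension_relations (E A : M →ₗ[K] V) :
    (betaObs E A = finrank K (V ⧸ LinearMap.range A) -
      (finrank K ↥(LinearMap.range E) - finrank K ↥(Submodule.map A (Mo E A)))) ∧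
    (betaCon E A =
        finrank K ↥(LinearMap.ker A) - finrank K ↥(LinearMap.ker (Ac E A)) ∧
      finrank K ↥(LinearMap.ker (Ac E A)) =
        finrank K ↥(Submodule.comap A (Submodule.map A (LinearMap.ker E))) -
          finrank K ↥(LinearMap.ker E)) ∧
    (finrank K (V ⧸ LinearMap.range E) -
        finrank K (↥(LinearMap.range E) ⧸ LinearMap.range (Eo E A)) =
        alpha1 E A + betaObs E A ∧
      finrank K (↥(LinearMap.range E) ⧸ LinearMap.range (Eo E A)) =
        finrank K ↥(LinearMap.range E) - finrank K ↥(Submodule.map E (Mo E A))) ∧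
    (finrank K ↥(LinearMap.ker E) - finrank K ↥(LinearMap.ker (Ec E A)) =
        alpha1 E A + betaCon E A ∧
      finrank K ↥(LinearMap.ker (Ec E A)) =
        finrank K ↥(Submodule.comap E (Submodule.map A (LinearMap.ker E))) -
          finrank K ↥(LinearMap.ker E)) := by
  have hEM := E.finrank_range_add_finrank_ker
  have hAM := A.finrank_range_add_finrank_ker
  have hcE := (LinearMap.range E).finrank_quotient_add_finrank
  have hcA := (LinearMap.range A).finrank_quotient_add_finrank
  have hcEA := (LinearMap.range E ⊔ LinearMap.range A).finrank_quotient_add_finrank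
  have hsup := Submodule.finrank_sup_add_finrank_inf_eq (LinearMap.range E) (LinearMap.range A)
  have hAMo : (Mo E A).map A = LinearMap.range E ⊓ LinearMap.range A := by
    rw [Mo, Submodule.map_comap_eq, inf_comm]
  have hMo : finrank K (Mo E A) = finrank K ↥(LinearMap.range E ⊓ LinearMap.range A) +
      finrank K (LinearMap.ker A) := by
    rw [Mo, finrank_comap_eq, inf_comm]
  have hAker := finrank_map_add_finrank_inf_ker A (LinearMap.ker E)
  have hEMo := finrank_map_add_finrank_inf_ker E (Mo E A)
  have hkerMo := finrank_map_add_finrank_inf_ker A (LinearMap.ker E ⊓ Mo E A)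
  have hker : LinearMap.ker E ⊓ Mo E A ⊓ LinearMap.ker A = LinearMap.ker E ⊓ LinearMap.ker A := by
    have hle : LinearMap.ker A ≤ Mo E A := LinearMap.ker_le_comap A
    rw [inf_assoc, inf_eq_right.mpr hle]
  rw [hker, Mo, ← Submodule.map_inf_eq_map_inf_comap, ← Mo, inf_comm _ (Mo E A)] at hkerMo
  have hAc : finrank K (LinearMap.ker (Ac E A)) + finrank K (LinearMap.ker E) =
      finrank K (((LinearMap.ker E).map A).comap A) := finrank_ker_liftQ_mkQ_comp _ _ _ _
  have hEc : finrank K (LinearMap.ker (Ec E A)) + finrank K (LinearMap.ker E) =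
      finrank K (((LinearMap.ker E).map A).comap E) := finrank_ker_liftQ_mkQ_comp _ _ _ _
  have hcomapA := finrank_comap_eq A ((LinearMap.ker E).map A)
  rw [inf_eq_right.mpr LinearMap.map_le_range] at hcomapA
  have hcomapE := finrank_comap_eq E ((LinearMap.ker E).map A)
  rw [inf_comm] at hcomapE
  have hα := alpha1_add_finrank_inf E A
  have hEo := finrank_coker_Eo_add E A
  have hle : finrank K ↥(LinearMap.range E ⊓ LinearMap.range A) ≤ finrank K (LinearMap.range E) :=
    Submodule.finrank_mono inf_le_left
  rw [hAMo]
  unfold betaObs betaCon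
  refine ⟨?_, ⟨?_, ?_⟩, ⟨?_, ?_⟩, ?_, ?_⟩ <;> lia

end PencilDefects

end
end

section
/- Let K be a field, M and V finite-dimensional K-vector spaces, and E, A : M →ₗ[K] V linear maps. Set M_o := {x ∈ M : A x ∈ range E}, V_o := range E, V_o² := Submodule.map E M_o, and M_o² := {x ∈ M : A x ∈ Submodule.map E M_o}. Then the following chain of inequalities holds: finrank(M_o) − finrank(M_o²) ≤ finrank(V_o) − finrank(V_o²) ≤ finrank(M) − finrank(M_o) ≤ finrank(V) − finrank(V_o). -/
/-!
Statement 17: with `M_o = {x | A x ∈ range E}`, `V_o = range E`, `V_o² = E(M_o)` and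
`M_o² = {x | A x ∈ E(M_o)}`, the successive differences of dimensions along the
observation reduction decrease:
`dim M_o − dim M_o² ≤ dim V_o − dim V_o² ≤ dim M − dim M_o ≤ dim V − dim V_o`.
-/

noncomputable section

open Module

theorem LinearMap.finrank_map_add_finrank_inf_ker {K M V : Type*} [Field K]
    [AddCommGroup M] [AddCommGroup V] [Module K M] [Module K V] [FiniteDimensional K M]
    (f : M →ₗ[K] V) (P : Submodule K M) :
    finrank K (P.map f) + finrank K ↥(P ⊓ LinearMap.ker f) = finrank K P := by
  have h := (f.domRestrict P).finrank_range_add_finrank_ker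
  have hker : (LinearMap.ker (f.domRestrict P)).map P.subtype = P ⊓ LinearMap.ker f := by
    rw [LinearMap.ker_domRestrict, Submodule.map_comap_subtype]
  rwa [LinearMap.range_domRestrict, ← Submodule.finrank_map_subtype_eq, hker] at h

theorem LinearMap.finrank_map_add_finrank_le {K M V : Type*} [Field K]
    [AddCommGroup M] [AddCommGroup V] [Module K M] [Module K V] [FiniteDimensional K M]
    (f : M →ₗ[K] V) {P Q : Submodule K M} (hPQ : P ≤ Q) :
    finrank K (Q.map f) + finrank K P ≤ finrank K (P.map f) + finrank K Q := by
  have hP := f.finrank_map_add_finrank_inf_ker P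
  have hQ := f.finrank_map_add_finrank_inf_ker Q
  have hle := Submodule.finrank_mono (inf_le_inf_right (LinearMap.ker f) hPQ)
  omega

theorem LinearMap.finrank_comap_eq_finrank_inf_range_add_finrank_ker {K M V : Type*} [Field K]
    [AddCommGroup M] [AddCommGroup V] [Module K M] [Module K V] [FiniteDimensional K M]
    (f : M →ₗ[K] V) (P : Submodule K V) :
    finrank K (P.comap f) =
      finrank K ↥(LinearMap.range f ⊓ P) + finrank K (LinearMap.ker f) := by
  rw [← f.finrank_map_add_finrank_inf_ker, Submodule.map_comap_eq,
    inf_eq_right.mpr (LinearMap.ker_le_comap f)]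

theorem LinearMap.finrank_comap_add_finrank_le {K M V : Type*} [Field K]
    [AddCommGroup M] [AddCommGroup V] [Module K M] [Module K V] [FiniteDimensional K M]
    [FiniteDimensional K V] (f : M →ₗ[K] V) {P Q : Submodule K V} (hPQ : P ≤ Q) :
    finrank K (Q.comap f) + finrank K P ≤ finrank K (P.comap f) + finrank K Q := by
  rw [f.finrank_comap_eq_finrank_inf_range_add_finrank_ker,
    f.finrank_comap_eq_finrank_inf_range_add_finrank_ker]
  have h := Submodule.finrank_sup_add_finrank_inf_eq (LinearMap.range f ⊓ Q) P
  rw [inf_assoc, inf_eq_right.mpr hPQ] at h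
  have hle := Submodule.finrank_mono (sup_le (inf_le_right : LinearMap.range f ⊓ Q ≤ Q) hPQ)
  omega

theorem reduction_dimension_differences_decrease
    {K : Type*} [Field K] {M V : Type*} [AddCommGroup M] [AddCommGroup V]
    [Module K M] [Module K V] [FiniteDimensional K M] [FiniteDimensional K V]
    (E A : M →ₗ[K] V) :
    finrank K ↥(Submodule.comap A (LinearMap.range E)) -
        finrank K ↥(Submodule.comap A
          (Submodule.map E (Submodule.comap A (LinearMap.range E)))) ≤
      finrank K ↥(LinearMap.range E) -
        finrank K ↥(Submodule.map E (Submodule.comap A (LinearMap.range E))) ∧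
    finrank K ↥(LinearMap.range E) -
        finrank K ↥(Submodule.map E (Submodule.comap A (LinearMap.range E))) ≤
      finrank K M - finrank K ↥(Submodule.comap A (LinearMap.range E)) ∧
    finrank K M - finrank K ↥(Submodule.comap A (LinearMap.range E)) ≤
      finrank K V - finrank K ↥(LinearMap.range E) := by
  have h₁ := A.finrank_comap_add_finrank_le
    (LinearMap.map_le_range (f := E) (p := (LinearMap.range E).comap A))
  have h₂ := E.finrank_map_add_finrank_le (le_top : (LinearMap.range E).comap A ≤ ⊤)
  have h₃ := A.finrank_comap_add_finrank_le (le_top : LinearMap.range E ≤ ⊤)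
  rw [Submodule.map_top, finrank_top] at h₂
  rw [Submodule.comap_top, finrank_top, finrank_top] at h₃
  omega
end
end

section
/- Let M and V be finite-dimensional real vector spaces and let (E,A) and (E',A') be two pairs of linear maps M →ₗ[ℝ] V. Say (E,A) and (E',A') are weakly equivalent if there exist linear automorphisms P of V and Q of M and a linear map R : M →ₗ[ℝ] M such that E' = P⁻¹ ∘ E ∘ Q and A' = P⁻¹ ∘ (E ∘ R + A ∘ Q). For a pair (E,A) define M_o := {x ∈ M : A x ∈ range E}, d(E,A) := finrank(Submodule.map E M_o), s(E,A) := finrank(range E) − finrank(Submodule.map E M_o), and a(E,A) := finrank((Submodule.map A (ker E) ⊔ range E) ⧸ range E). Then (E,A) and (E',A') are weakly equivalent if and only if d(E,A) = d(E',A'), a(E,A) = a(E',A'), and s(E,A) = s(E',A'). -/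
/-!
Statement 19: two pairs `(E,A)`, `(E',A')` of linear maps between finite-dimensional real
vector spaces `M`, `V` are weakly equivalent (i.e. `E' = P⁻¹ E Q`,
`A' = P⁻¹ (E R + A Q)` for automorphisms `P`, `Q` and some linear `R`) if and only if
the three invariants `d = dim E(M_o)`, `a = rank (ker E → V ⧸ range E)` and the
strangeness `s = dim (range E) − dim E(M_o)` coincide.
-/

noncomputable section

namespace Strangeness

open Module

variable {M V : Type*} [AddCommGroup M] [AddCommGroup V] [Module ℝ M] [Module ℝ V]

/-- Weak equivalence of the systems `(E,A)` and `(E',A')`. -/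
def WeaklyEquivalent (E A E' A' : M →ₗ[ℝ] V) : Prop :=
  ∃ (P : V ≃ₗ[ℝ] V) (Q : M ≃ₗ[ℝ] M) (Rm : M →ₗ[ℝ] M),
    E' = P.symm.toLinearMap ∘ₗ E ∘ₗ Q.toLinearMap ∧
    A' = P.symm.toLinearMap ∘ₗ (E ∘ₗ Rm + A ∘ₗ Q.toLinearMap)

/-- `M_o = {x | A x ∈ range E}`. -/
def Mo (E A : M →ₗ[ℝ] V) : Submodule ℝ M := Submodule.comap A (LinearMap.range E)

/-- `d = dim V_o² = dim E(M_o)`. -/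
def dInv (E A : M →ₗ[ℝ] V) : ℕ := finrank ℝ ↥(Submodule.map E (Mo E A))

/-- The strangeness `s = dim (V_o ⧸ V_o²) = dim (range E) − dim E(M_o)`. -/
def sInv (E A : M →ₗ[ℝ] V) : ℕ :=
  finrank ℝ ↥(LinearMap.range E) - finrank ℝ ↥(Submodule.map E (Mo E A))

/-- `a = dim coim pr(A)`, the rank of the map `ker E → V ⧸ range E` induced by `A`. -/
def aInv (E A : M →ₗ[ℝ] V) : ℕ :=
  finrank ℝ
    ↥(LinearMap.range ((LinearMap.range E).mkQ ∘ₗ A ∘ₗ (LinearMap.ker E).subtype))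

section Extension

variable {K U W : Type*} [Field K] [AddCommGroup U] [AddCommGroup W] [Module K U] [Module K W]

/-- Two injective linear maps into a finite-dimensional space differ by an automorphism. -/
theorem exists_linearEquiv_comp_eq_of_injective [FiniteDimensional K W] {i j : U →ₗ[K] W}
    (hi : Function.Injective i) (hj : Function.Injective j) :
    ∃ P : W ≃ₗ[K] W, ∀ u, P (i u) = j u := by
  obtain ⟨C, hC⟩ := (LinearMap.range i).exists_isCompl
  obtain ⟨D, hD⟩ := (LinearMap.range j).exists_isCompl
  let e : LinearMap.range i ≃ₗ[K] LinearMap.range j :=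
    (LinearEquiv.ofInjective i hi).symm ≪≫ₗ LinearEquiv.ofInjective j hj
  have hCD : finrank K C = finrank K D := by
    have h₁ := Submodule.finrank_add_eq_of_isCompl hC
    have h₂ := Submodule.finrank_add_eq_of_isCompl hD
    have h₃ := e.finrank_eq
    omega
  let f : C ≃ₗ[K] D := LinearEquiv.ofFinrankEq _ _ hCD
  refine ⟨(Submodule.prodEquivOfIsCompl _ _ hC).symm ≪≫ₗ e.prodCongr f ≪≫ₗ
    Submodule.prodEquivOfIsCompl _ _ hD, fun u => ?_⟩
  have h : (Submodule.prodEquivOfIsCompl _ _ hC).symm (i u) =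
      (LinearEquiv.ofInjective i hi u, 0) :=
    Submodule.prodEquivOfIsCompl_symm_apply_left _ _ hC (LinearEquiv.ofInjective i hi u)
  simp [h, e]

theorem finrank_comap_linearEquiv (Q : W ≃ₗ[K] W) (S : Submodule K W) :
    finrank K (S.comap Q.toLinearMap) = finrank K S := by
  rw [← LinearEquiv.finrank_map_eq Q.symm S, Submodule.map_equiv_eq_comap_symm]
  rfl

/-- If an automorphism maps `S'` into a subspace `S` of the same dimension, then `S'` is the
preimage of `S`. -/
theorem eq_comap_of_finrank_eq [FiniteDimensional K W] {S S' : Submodule K W} (Q : W ≃ₗ[K] W)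
    (h : finrank K S = finrank K S') (hle : S' ≤ S.comap Q.toLinearMap) :
    S' = S.comap Q.toLinearMap := by
  refine Submodule.eq_of_le_of_finrank_eq hle ?_
  rw [finrank_comap_linearEquiv, h]

theorem injective_coprod_inf_of_disjoint {S T : Submodule K W}
    {C D : Submodule K W} (hST : Disjoint (S ⊓ T) C) (hC : C ≤ S) (hTD : Disjoint (S ⊓ T) D)
    (hD : D ≤ T) {U₁ U₂ U₃ : Type*} [AddCommGroup U₁] [AddCommGroup U₂] [AddCommGroup U₃]
    [Module K U₁] [Module K U₂] [Module K U₃]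
    (e₁ : U₁ ≃ₗ[K] ↥(S ⊓ T)) (e₂ : U₂ ≃ₗ[K] C) (e₃ : U₃ ≃ₗ[K] D) :
    Function.Injective (((S ⊓ T).subtype ∘ₗ e₁.toLinearMap).coprod
      ((C.subtype ∘ₗ e₂.toLinearMap).coprod (D.subtype ∘ₗ e₃.toLinearMap))) := by
  rw [injective_iff_map_eq_zero]
  rintro ⟨x, y, z⟩ h
  simp only [LinearMap.coprod_apply, LinearMap.comp_apply, Submodule.subtype_apply,
    LinearEquiv.coe_coe] at h
  have hx := (e₁ x).2
  have hy := (e₂ y).2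
  have hz := (e₃ z).2
  have hzS : (e₃ z : W) ∈ S := by
    have : (e₃ z : W) = -((e₁ x : W) + e₂ y) := by
      rw [eq_neg_iff_add_eq_zero, ← h]; abel
    rw [this]
    exact S.neg_mem (S.add_mem hx.1 (hC hy))
  have hz₀ : (e₃ z : W) = 0 := Submodule.disjoint_def.1 hTD _ ⟨hzS, hD hz⟩ hz
  rw [hz₀, add_zero] at h
  have hy₀ : (e₂ y : W) = 0 := by
    refine Submodule.disjoint_def.1 hST _ ?_ hy
    rw [eq_neg_of_add_eq_zero_right h]
    exact (S ⊓ T).neg_mem hx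
  rw [hy₀, add_zero] at h
  simp only [ZeroMemClass.coe_eq_zero, map_eq_zero_iff _ (LinearEquiv.injective _)] at h hy₀ hz₀
  simp [h, hy₀, hz₀]

/-- A subspace `I` of `S` has a complement inside `S`. -/
theorem exists_disjoint_sup_eq {I S : Submodule K W} (h : I ≤ S) :
    ∃ C : Submodule K W, Disjoint I C ∧ I ⊔ C = S := by
  obtain ⟨C, hC⟩ := I.exists_isCompl
  refine ⟨C ⊓ S, hC.disjoint.mono_right inf_le_left, ?_⟩
  rw [← sup_inf_assoc_of_le C h, hC.sup_eq_top, top_inf_eq]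

/-- Pairs of subspaces are classified, up to automorphisms of the ambient space, by the dimensions
of the two subspaces and of their intersection. -/
theorem exists_linearEquiv_eq_comap_iff [FiniteDimensional K W] (S T S' T' : Submodule K W) :
    (∃ Q : W ≃ₗ[K] W, S' = S.comap Q.toLinearMap ∧ T' = T.comap Q.toLinearMap) ↔
      finrank K S = finrank K S' ∧ finrank K T = finrank K T' ∧
        finrank K ↥(S ⊓ T) = finrank K ↥(S' ⊓ T') := by
  constructor
  · rintro ⟨Q, rfl, rfl⟩
    rw [← Submodule.comap_inf]
    simp only [finrank_comap_linearEquiv, and_self]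
  rintro ⟨hS, hT, hI⟩
  obtain ⟨C, hC, hCS⟩ := exists_disjoint_sup_eq (inf_le_left : S ⊓ T ≤ S)
  obtain ⟨D, hD, hDT⟩ := exists_disjoint_sup_eq (inf_le_right : S ⊓ T ≤ T)
  obtain ⟨C', hC', hCS'⟩ := exists_disjoint_sup_eq (inf_le_left : S' ⊓ T' ≤ S')
  obtain ⟨D', hD', hDT'⟩ := exists_disjoint_sup_eq (inf_le_right : S' ⊓ T' ≤ T')
  have key : ∀ {I J : Submodule K W}, Disjoint I J →
      finrank K ↥(I ⊔ J) = finrank K I + finrank K J := by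
    intro I J h
    have := Submodule.finrank_sup_add_finrank_inf_eq I J
    rwa [h.eq_bot, finrank_bot, add_zero] at this
  have hCC : finrank K C' = finrank K C := by
    have h₁ := key hC
    have h₂ := key hC'
    rw [hCS] at h₁
    rw [hCS'] at h₂
    omega
  have hDD : finrank K D' = finrank K D := by
    have h₁ := key hD
    have h₂ := key hD'
    rw [hDT] at h₁
    rw [hDT'] at h₂
    omega
  let e₁ : ↥(S' ⊓ T') ≃ₗ[K] ↥(S ⊓ T) := LinearEquiv.ofFinrankEq _ _ hI.symm
  let e₂ : C' ≃ₗ[K] C := LinearEquiv.ofFinrankEq _ _ hCC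
  let e₃ : D' ≃ₗ[K] D := LinearEquiv.ofFinrankEq _ _ hDD
  have hCS_le : C ≤ S := hCS ▸ le_sup_right
  have hDT_le : D ≤ T := hDT ▸ le_sup_right
  obtain ⟨Q, hQ⟩ := exists_linearEquiv_comp_eq_of_injective
    (injective_coprod_inf_of_disjoint hC' (hCS' ▸ le_sup_right) hD' (hDT' ▸ le_sup_right)
      (LinearEquiv.refl K _) (LinearEquiv.refl K _) (LinearEquiv.refl K _))
    (injective_coprod_inf_of_disjoint hC hCS_le hD hDT_le e₁ e₂ e₃)
  have hQ₁ : ∀ x ∈ S' ⊓ T', Q x ∈ S ⊓ T := fun x hx => by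
    have h : Q x = e₁ ⟨x, hx⟩ := by simpa using hQ (⟨x, hx⟩, 0, 0)
    exact h ▸ (e₁ ⟨x, hx⟩).2
  have hQ₂ : ∀ x ∈ C', Q x ∈ C := fun x hx => by
    have h : Q x = e₂ ⟨x, hx⟩ := by simpa using hQ (0, ⟨x, hx⟩, 0)
    exact h ▸ (e₂ ⟨x, hx⟩).2
  have hQ₃ : ∀ x ∈ D', Q x ∈ D := fun x hx => by
    have h : Q x = e₃ ⟨x, hx⟩ := by simpa using hQ (0, 0, ⟨x, hx⟩)
    exact h ▸ (e₃ ⟨x, hx⟩).2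
  refine ⟨Q, eq_comap_of_finrank_eq Q hS ?_, eq_comap_of_finrank_eq Q hT ?_⟩
  · rw [← hCS', sup_le_iff]
    exact ⟨fun x hx => (hQ₁ x hx).1, fun x hx => hCS_le (hQ₂ x hx)⟩
  · rw [← hDT', sup_le_iff]
    exact ⟨fun x hx => (hQ₁ x hx).2, fun x hx => hDT_le (hQ₃ x hx)⟩

/-- A linear map with values in the range of `f` factors through `f`. -/
theorem exists_comp_eq_of_range_le {X : Type*} [AddCommGroup X] [Module K X] (f : W →ₗ[K] X)
    (g : U →ₗ[K] X) (h : ∀ u, g u ∈ LinearMap.range f) : ∃ r : U →ₗ[K] W, f ∘ₗ r = g := by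
  obtain ⟨r, hr⟩ := Module.projective_lifting_property f.rangeRestrict
    (g.codRestrict (LinearMap.range f) h) f.surjective_rangeRestrict
  exact ⟨r, LinearMap.ext fun u => congrArg Subtype.val (LinearMap.congr_fun hr u)⟩

end Extension

theorem mem_Mo {E A : M →ₗ[ℝ] V} {x : M} : x ∈ Mo E A ↔ A x ∈ LinearMap.range E := Iff.rfl

theorem dInv_add_finrank [FiniteDimensional ℝ M] (E A : M →ₗ[ℝ] V) :
    dInv E A + finrank ℝ ↥(LinearMap.ker E ⊓ Mo E A) = finrank ℝ (Mo E A) := by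
  have h := LinearMap.finrank_range_add_finrank_ker (E.domRestrict (Mo E A))
  rw [LinearMap.range_domRestrict, LinearMap.ker_domRestrict,
    ← Submodule.finrank_map_subtype_eq, Submodule.map_comap_subtype, inf_comm] at h
  exact h

theorem aInv_add_finrank [FiniteDimensional ℝ M] (E A : M →ₗ[ℝ] V) :
    aInv E A + finrank ℝ ↥(LinearMap.ker E ⊓ Mo E A) = finrank ℝ (LinearMap.ker E) := by
  have h := LinearMap.finrank_range_add_finrank_ker
    ((LinearMap.range E).mkQ ∘ₗ A ∘ₗ (LinearMap.ker E).subtype)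
  have hk : LinearMap.ker ((LinearMap.range E).mkQ ∘ₗ A ∘ₗ (LinearMap.ker E).subtype) =
      (Mo E A).comap (LinearMap.ker E).subtype := by
    rw [LinearMap.ker_comp, Submodule.ker_mkQ, Submodule.comap_comp, Mo]
  rw [hk, ← Submodule.finrank_map_subtype_eq, Submodule.map_comap_subtype] at h
  exact h

theorem dInv_add_sInv_add_finrank [FiniteDimensional ℝ M] (E A : M →ₗ[ℝ] V) :
    dInv E A + sInv E A + finrank ℝ (LinearMap.ker E) = finrank ℝ M := by
  have hle : dInv E A ≤ finrank ℝ (LinearMap.range E) :=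
    Submodule.finrank_mono LinearMap.map_le_range
  rw [← LinearMap.finrank_range_add_finrank_ker E, sInv, ← dInv, Nat.add_sub_cancel' hle]

theorem weaklyEquivalent_iff_exists_eq_comap [FiniteDimensional ℝ M] [FiniteDimensional ℝ V]
    (E A E' A' : M →ₗ[ℝ] V) :
    WeaklyEquivalent E A E' A' ↔ ∃ Q : M ≃ₗ[ℝ] M,
      LinearMap.ker E' = (LinearMap.ker E).comap Q.toLinearMap ∧
        Mo E' A' = (Mo E A).comap Q.toLinearMap := by
  constructor
  · rintro ⟨P, Q, R, rfl, rfl⟩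
    refine ⟨Q, by ext x; simp, ?_⟩
    ext x
    simp only [mem_Mo, Submodule.mem_comap, LinearMap.mem_range, LinearMap.comp_apply,
      LinearMap.add_apply, LinearEquiv.coe_coe, EmbeddingLike.apply_eq_iff_eq]
    constructor
    · rintro ⟨y, hy⟩
      exact ⟨Q y - R x, by rw [map_sub, hy, add_sub_cancel_left]⟩
    · rintro ⟨y, hy⟩
      exact ⟨Q.symm (y + R x), by rw [Q.apply_symm_apply, map_add, hy, add_comm]⟩
  rintro ⟨Q, hK, hN⟩
  have hK : ∀ x, E' x = 0 ↔ E (Q x) = 0 := fun x => by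
    simpa using SetLike.ext_iff.1 hK x
  have hN : ∀ x, A' x ∈ LinearMap.range E' ↔ A (Q x) ∈ LinearMap.range E :=
    fun x => SetLike.ext_iff.1 hN x
  obtain ⟨σ, hσ⟩ := exists_comp_eq_of_range_le E' (LinearMap.range E').subtype fun u => u.2
  have hσ : ∀ y, E' (σ y) = y := LinearMap.congr_fun hσ
  obtain ⟨L, hL⟩ := (Mo E' A').exists_isCompl
  have hL₀ : ∀ x : L, A' x ∈ LinearMap.range E' → x = 0 := fun x hx =>
    Subtype.ext (Submodule.disjoint_def.1 hL.disjoint _ hx x.2)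
  have hi : Function.Injective ((LinearMap.range E').subtype.coprod (A' ∘ₗ L.subtype)) := by
    rw [injective_iff_map_eq_zero]
    rintro ⟨y, x⟩ h
    replace h : (y : V) + A' x = 0 := h
    obtain rfl : x = 0 := hL₀ x <| by
      rw [eq_neg_of_add_eq_zero_right h]
      exact Submodule.neg_mem _ y.2
    simpa using h
  have hj : Function.Injective
      ((E ∘ₗ Q.toLinearMap ∘ₗ σ).coprod (A ∘ₗ Q.toLinearMap ∘ₗ L.subtype)) := by
    rw [injective_iff_map_eq_zero]
    rintro ⟨y, x⟩ h
    replace h : E (Q (σ y)) + A (Q x) = 0 := h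
    obtain rfl : x = 0 := hL₀ x <| by
      rw [hN, eq_neg_of_add_eq_zero_right h]
      exact Submodule.neg_mem _ (LinearMap.mem_range_self _ _)
    have h₀ : E' (σ y) = 0 := (hK _).2 (by simpa using h)
    rw [hσ] at h₀
    simpa using h₀
  obtain ⟨P, hP⟩ := exists_linearEquiv_comp_eq_of_injective hi hj
  have hPE : ∀ x, P (E' x) = E (Q x) := fun x => by
    have h₁ : P (E' x) = E (Q (σ ⟨E' x, LinearMap.mem_range_self _ _⟩)) := by
      simpa using hP (⟨E' x, LinearMap.mem_range_self _ _⟩, 0)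
    rw [h₁, ← sub_eq_zero, ← map_sub, ← map_sub, ← hK, map_sub, hσ, sub_self]
  have hPA : ∀ x : L, P (A' x) = A (Q x) := fun x => by simpa using hP (0, x)
  obtain ⟨R, hR⟩ := exists_comp_eq_of_range_le E
    (P.toLinearMap ∘ₗ A' - A ∘ₗ Q.toLinearMap) fun x => by
      obtain ⟨n, hn, l, hl, rfl⟩ := Submodule.mem_sup.1 (hL.sup_eq_top ▸ Submodule.mem_top :
        x ∈ Mo E' A' ⊔ L)
      have hl' : P (A' l) = A (Q l) := hPA ⟨l, hl⟩
      have hx : (P.toLinearMap ∘ₗ A' - A ∘ₗ Q.toLinearMap) (n + l) = P (A' n) - A (Q n) := by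
        simp [hl']
      rw [hx]
      refine Submodule.sub_mem _ ?_ ((hN n).1 hn)
      obtain ⟨z, hz⟩ := mem_Mo.1 hn
      exact ⟨Q z, by rw [← hPE, hz]⟩
  refine ⟨P, Q, R, ?_, ?_⟩
  · ext x
    simp [← hPE]
  · ext x
    simp [hR]

theorem weaklyEquivalent_iff_invariants [FiniteDimensional ℝ M] [FiniteDimensional ℝ V]
    (E A E' A' : M →ₗ[ℝ] V) :
    WeaklyEquivalent E A E' A' ↔
      dInv E A = dInv E' A' ∧ aInv E A = aInv E' A' ∧ sInv E A = sInv E' A' := by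
  rw [weaklyEquivalent_iff_exists_eq_comap, exists_linearEquiv_eq_comap_iff]
  have h₁ := dInv_add_finrank E A
  have h₂ := aInv_add_finrank E A
  have h₃ := dInv_add_sInv_add_finrank E A
  have h₁' := dInv_add_finrank E' A'
  have h₂' := aInv_add_finrank E' A'
  have h₃' := dInv_add_sInv_add_finrank E' A'
  omega

end Strangeness

end
end
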